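/- arXiv:1210.4533 — 6 statements merged into one kernel-verified Lean document; each statement's English description precedes it below -/
import Mathlib

section
/- Let A be a C*-algebra, let a, b be positive contractions in A, let v ∈ A with ‖v‖ ≤ 1, and let δ > 0 satisfy ‖v* b v a − a‖ ≤ δ. Suppose 0 < β < 1 and γ ≥ 0 satisfy γ + δ·β⁻¹ < 1. Then (a−β)₊ ≾ (b−γ)₊ in A. -/
open Filter Topology

variable {A : Type*} [NonUnitalCStarAlgebra A] [PartialOrder A] [StarOrderedRing A]

/-- Cuntz subequivalence `a ≾ b` in a C*-algebra: there is a sequence `(vₙ)` in `A`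
with `‖vₙ b vₙ* − a‖ → 0`. -/
def CuntzBelow (a b : A) : Prop :=
  ∃ v : ℕ → A, Tendsto (fun n => ‖v n * b * star (v n) - a‖) atTop (𝓝 0)

/-- `(a − ε)₊`, the result of applying `t ↦ max (t − ε) 0` to `a` by the
continuous functional calculus. -/
noncomputable def cutP (a : A) (ε : ℝ) : A := cfcₙ (fun t : ℝ => max (t - ε) 0) a

/-- A sequence of positive contractions is rapidly increasing if for each `n` there is
`ε > 0` with `aₙ ≾ (a_{n+1} − ε)₊`. -/
def RapidlyIncreasing (a : ℕ → A) : Prop :=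
  ∀ n, ∃ ε > (0 : ℝ), CuntzBelow (a n) (cutP (a (n + 1)) ε)

/-- A sequence of positive contractions is very rapidly increasing if it is rapidly increasing
and for every `ε > 0` and every `n` there is `m₀` such that for all `m ≥ m₀` there is a
contraction `v` with `‖(v aₘ v*) aₙ − aₙ‖ < ε`. -/
def VeryRapidlyIncreasing (a : ℕ → A) : Prop :=
  RapidlyIncreasing a ∧
    ∀ ε > (0 : ℝ), ∀ n, ∃ m₀, ∀ m ≥ m₀,
      ∃ v : A, ‖v‖ ≤ 1 ∧ ‖v * a m * star v * a n - a n‖ < ε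

lemma aux_sqrt (x : A) (hx : 0 ≤ x) : ∃ e : A, star e = e ∧ e * e = x :=
  ⟨CFC.sqrt x, (IsSelfAdjoint.of_nonneg (CFC.sqrt_nonneg x)).star_eq, CFC.sqrt_mul_sqrt_self x⟩

lemma aux_approx (y : A) (hy : 0 ≤ y) (r : ℝ) (hr : 0 < r) :
    ∃ q k m : A, star q = q ∧ star k = k ∧ star m = m ∧ q * q = y ∧ k * y * k = m * m ∧
      ‖q - q * m‖ ≤ r := by
  have hsa : IsSelfAdjoint y := .of_nonneg hy
  have hpos : ∀ t : ℝ, |t| + r ^ 2 ≠ 0 := fun t => by positivity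
  have hck : Continuous (fun t : ℝ => √t / (|t| + r ^ 2)) := by
    exact Continuous.div (by fun_prop) (by fun_prop) hpos
  have hcm : Continuous (fun t : ℝ => t / (|t| + r ^ 2)) := by
    exact Continuous.div (by fun_prop) (by fun_prop) hpos
  have hq : cfcₙ (fun t : ℝ => √t) y * cfcₙ (fun t : ℝ => √t) y = y := by
    rw [← cfcₙ_mul (fun t : ℝ => √t) (fun t : ℝ => √t) y]
    conv_rhs => rw [← cfcₙ_id ℝ y]
    exact cfcₙ_congr fun t ht => Real.mul_self_sqrt (quasispectrum_nonneg_of_nonneg y hy t ht)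
  have hkq : cfcₙ (fun t : ℝ => √t / (|t| + r ^ 2)) y * cfcₙ (fun t : ℝ => √t) y
      = cfcₙ (fun t : ℝ => t / (|t| + r ^ 2)) y := by
    rw [← cfcₙ_mul (fun t : ℝ => √t / (|t| + r ^ 2)) (fun t : ℝ => √t) y hck.continuousOn]
    refine cfcₙ_congr fun t ht => ?_
    have := Real.mul_self_sqrt (quasispectrum_nonneg_of_nonneg y hy t ht)
    simp only [div_mul_eq_mul_div, this]
  have hqk : cfcₙ (fun t : ℝ => √t) y * cfcₙ (fun t : ℝ => √t / (|t| + r ^ 2)) y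
      = cfcₙ (fun t : ℝ => t / (|t| + r ^ 2)) y := by
    rw [← hkq]; exact cfcₙ_commute_cfcₙ _ _ _
  refine ⟨cfcₙ (fun t : ℝ => √t) y, cfcₙ (fun t : ℝ => √t / (|t| + r ^ 2)) y,
    cfcₙ (fun t : ℝ => t / (|t| + r ^ 2)) y, (cfcₙ_predicate _ y : IsSelfAdjoint _).star_eq,
    (cfcₙ_predicate _ y : IsSelfAdjoint _).star_eq,
    (cfcₙ_predicate _ y : IsSelfAdjoint _).star_eq, hq, ?_, ?_⟩
  · conv_lhs => enter [1, 2]; rw [← hq]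
    rw [← mul_assoc, hkq, mul_assoc, hqk]
  · rw [← cfcₙ_mul (fun t : ℝ => √t) (fun t : ℝ => t / (|t| + r ^ 2)) y (by fun_prop) (by simp)
      hcm.continuousOn, ← cfcₙ_sub (fun t : ℝ => √t) (fun t : ℝ => √t * (t / (|t| + r ^ 2))) y
        (by fun_prop) (by simp) (Continuous.continuousOn (by fun_prop))]
    refine norm_cfcₙ_le fun t ht => ?_
    have h0 := quasispectrum_nonneg_of_nonneg y hy t ht
    have h1 := Real.mul_self_sqrt h0
    have h2 := Real.sqrt_nonneg t
    have hp : 0 < t + r ^ 2 := by positivity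
    have : √t - √t * (t / (|t| + r ^ 2)) = √t * r ^ 2 / (t + r ^ 2) := by
      rw [abs_of_nonneg h0]; field_simp; ring
    rw [this, Real.norm_of_nonneg (by positivity), div_le_iff₀ hp]
    have : √t * r ≤ t + r ^ 2 := by nlinarith [sq_nonneg (√t - r)]
    nlinarith

lemma aux_norm (e q s m : A) (h : star e * e + star s * s = star q * q) :
    ‖e - e * m‖ ≤ ‖q - q * m‖ := by
  have key : ∀ z : A, star (z - z * m) * (z - z * m) = star z * z - star z * z * m
      - star m * (star z * z) + star m * (star z * z) * m := by
    intro z; simp only [star_sub, star_mul]; noncomm_ring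
  have hle : star (e - e * m) * (e - e * m) ≤ star (q - q * m) * (q - q * m) := by
    have : star (q - q * m) * (q - q * m) =
        star (e - e * m) * (e - e * m) + star (s - s * m) * (s - s * m) := by
      rw [key, key, key, ← h]; noncomm_ring
    rw [this]
    exact le_add_of_nonneg_right (star_mul_self_nonneg _)
  have := CStarAlgebra.norm_le_norm_of_nonneg_of_le (star_mul_self_nonneg _) hle
  rw [CStarRing.norm_star_mul_self, CStarRing.norm_star_mul_self] at this
  exact le_of_not_gt fun hlt => by nlinarith [norm_nonneg (e - e * m), norm_nonneg (q - q * m)]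

lemma aux_cuntz_of_le (x y : A) (hx : 0 ≤ x) (hxy : x ≤ y) : CuntzBelow x y := by
  obtain ⟨e, he, hee⟩ := aux_sqrt x hx
  obtain ⟨s, hs, hss⟩ := aux_sqrt (y - x) (sub_nonneg.2 hxy)
  have hy : 0 ≤ y := hx.trans hxy
  choose q k m hq hk hm hqq hkm hn using
    fun n : ℕ => aux_approx y hy (1 / ((n : ℝ) + 1)) (by positivity)
  refine ⟨fun n => e * k n, ?_⟩
  have h1 : ∀ n, ‖e - e * m n‖ ≤ 1 / ((n : ℝ) + 1) := fun n =>
    (aux_norm e (q n) s (m n) (by rw [he, hs, hq, hee, hss, hqq]; abel)).trans (hn n)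
  have h2 : Tendsto (fun n => e * m n) atTop (𝓝 e) := by
    rw [tendsto_iff_norm_sub_tendsto_zero]
    refine squeeze_zero (fun _ => norm_nonneg _) (fun n => ?_)
      (tendsto_one_div_add_atTop_nhds_zero_nat (𝕜 := ℝ))
    rw [norm_sub_rev]; exact h1 n
  have h3 : Tendsto (fun n => (e * m n) * star (e * m n)) atTop (𝓝 (e * star e)) :=
    h2.mul h2.star
  rw [he, hee, tendsto_iff_norm_sub_tendsto_zero] at h3
  refine h3.congr fun n => ?_
  congr 2
  simp only [star_mul, he, hk, hm]
  calc e * m n * (m n * e) = e * (m n * m n) * e := by simp only [mul_assoc]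
    _ = e * (k n * y * k n) * e := by rw [hkm]
    _ = _ := by simp only [mul_assoc]

lemma aux_cuntz_conj (x b w : A) (h : CuntzBelow x (w * b * star w)) : CuntzBelow x b := by
  obtain ⟨v, hv⟩ := h
  refine ⟨fun n => v n * w, hv.congr fun n => ?_⟩
  simp only [star_mul, mul_assoc]

lemma aux_h (a : A) (ha : 0 ≤ a) (β : ℝ) (hβ : 0 < β) :
    ∃ h e : A, star h = h ∧ star e = e ∧ ‖h‖ ≤ β⁻¹ ∧ e * e = cutP a β ∧ a * h = h * a ∧
      e * (a * h) = e ∧ ‖a * h‖ ≤ 1 := by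
  have hsa : IsSelfAdjoint a := .of_nonneg ha
  have hpos : ∀ t : ℝ, β * max t β ≠ 0 := fun t => by positivity
  have hch : Continuous (fun t : ℝ => min t β / (β * max t β)) :=
    Continuous.div (by fun_prop) (by fun_prop) hpos
  have hh0 : (fun t : ℝ => min t β / (β * max t β)) 0 = 0 := by simp [hβ.le]
  have he0 : (fun t : ℝ => √(max (t - β) 0)) 0 = 0 := by simp [hβ.le]
  have hah : a * cfcₙ (fun t : ℝ => min t β / (β * max t β)) a
      = cfcₙ (fun t : ℝ => t * (min t β / (β * max t β))) a := by
    rw [cfcₙ_mul (fun t : ℝ => t) (fun t : ℝ => min t β / (β * max t β)) a (by fun_prop) rfl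
      hch.continuousOn hh0, cfcₙ_id' ℝ a]
  refine ⟨cfcₙ (fun t : ℝ => min t β / (β * max t β)) a, cfcₙ (fun t : ℝ => √(max (t - β) 0)) a,
    (cfcₙ_predicate _ a : IsSelfAdjoint _).star_eq,
    (cfcₙ_predicate _ a : IsSelfAdjoint _).star_eq, ?_, ?_, ?_, ?_, ?_⟩
  · refine norm_cfcₙ_le fun t ht => ?_
    have h0 := quasispectrum_nonneg_of_nonneg a ha t ht
    have : 0 < max t β := lt_max_of_lt_right hβ
    have h1 : 0 ≤ min t β := le_min h0 hβ.le
    rw [Real.norm_of_nonneg (by positivity), div_le_iff₀ (by positivity), inv_mul_cancel_left₀ hβ.ne']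
    exact min_le_max
  · rw [← cfcₙ_mul _ _ a (by fun_prop) he0 (by fun_prop) he0]
    exact cfcₙ_congr fun t ht => Real.mul_self_sqrt (le_max_right _ _)
  · conv_lhs => rw [← cfcₙ_id' ℝ a]
    conv_rhs => rw [← cfcₙ_id' ℝ a]
    rw [cfcₙ_id' ℝ a]
    have := cfcₙ_commute_cfcₙ (fun t : ℝ => t) (fun t : ℝ => min t β / (β * max t β)) a
    rw [cfcₙ_id' ℝ a] at this
    exact this
  · rw [hah, ← cfcₙ_mul _ _ a (by fun_prop) he0 (Continuous.continuousOn (by fun_prop)) (by simp)]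
    refine cfcₙ_congr fun t ht => ?_
    rcases le_total t β with h | h
    · simp [max_eq_right (sub_nonpos.2 h)]
    · rw [min_eq_right h, max_eq_left h]
      have : t ≠ 0 := (hβ.trans_le h).ne'
      field_simp
  · rw [hah]
    refine norm_cfcₙ_le fun t ht => ?_
    have h0 := quasispectrum_nonneg_of_nonneg a ha t ht
    have : 0 < max t β := lt_max_of_lt_right hβ
    have h1 : 0 ≤ min t β := le_min h0 hβ.le
    rw [Real.norm_of_nonneg (by positivity), ← mul_div_assoc, div_le_one (by positivity),
      mul_comm β]
    exact mul_le_mul (le_max_left _ _) (min_le_right _ _) h1 this.le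

lemma aux_cut (b : A) (hb : 0 ≤ b) (γ : ℝ) (hγ : 0 ≤ γ) :
    ‖b - cutP b γ‖ ≤ γ ∧ IsSelfAdjoint (b - cutP b γ) := by
  have hsa : IsSelfAdjoint b := .of_nonneg hb
  refine ⟨?_, hsa.sub (cfcₙ_predicate _ b)⟩
  have : b - cutP b γ = cfcₙ (fun t : ℝ => t - max (t - γ) 0) b := by
    rw [cfcₙ_sub (fun t : ℝ => t) (fun t : ℝ => max (t - γ) 0) b (by fun_prop) rfl (by fun_prop)
      (by simp [hγ]), cfcₙ_id' ℝ b, cutP]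
  rw [this]
  refine norm_cfcₙ_le fun t ht => ?_
  have h0 := quasispectrum_nonneg_of_nonneg b hb t ht
  rw [Real.norm_eq_abs, abs_le]
  rcases max_cases (t - γ) 0 with h | h <;> constructor <;> linarith [h.1, h.2]

theorem stmt1 (a b v : A) (ha : 0 ≤ a) (ha1 : ‖a‖ ≤ 1) (hb : 0 ≤ b) (hb1 : ‖b‖ ≤ 1)
    (hv : ‖v‖ ≤ 1) (δ : ℝ) (hδ : 0 < δ) (hba : ‖star v * b * v * a - a‖ ≤ δ)
    (β γ : ℝ) (hβ0 : 0 < β) (hβ1 : β < 1) (hγ : 0 ≤ γ) (hsum : γ + δ * β⁻¹ < 1) :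
    CuntzBelow (cutP a β) (cutP b γ) := by
  obtain ⟨h, e, hh, he, hhn, hee, hcomm, hg, hgn⟩ := aux_h a ha β hβ0
  obtain ⟨hbn, hbsa⟩ := aux_cut b hb γ hγ
  have hsa : star a = a := (IsSelfAdjoint.of_nonneg ha).star_eq
  have hsb : star b = b := (IsSelfAdjoint.of_nonneg hb).star_eq
  obtain ⟨g, hgdef⟩ : ∃ g, g = a * h := ⟨_, rfl⟩
  have hgs : star g = g := by rw [hgdef, star_mul, hh, hsa, hcomm]
  rw [← hgdef] at hg hgn
  have hge : g * e = e := by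
    have := congrArg star hg
    rwa [star_mul, he, hgs] at this
  set x := cutP a β with hx
  have hx0 : 0 ≤ x := by
    have := star_mul_self_nonneg e
    rwa [he, hee] at this
  obtain ⟨D, hD⟩ : ∃ D, D = g * g - g * (star v * b * v) * g := ⟨_, rfl⟩
  have hDs : IsSelfAdjoint D := by
    rw [IsSelfAdjoint, hD]
    simp only [star_sub, star_mul, hgs, hsb, star_star, mul_assoc]
  have hDn : ‖D‖ ≤ δ * β⁻¹ := by
    have : D = -(g * ((star v * b * v * a - a) * h)) := by
      rw [hD]; nth_rewrite 2 [hgdef]; nth_rewrite 3 [hgdef]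
      nth_rewrite 1 [hgdef]
      simp only [hgdef, sub_mul, mul_sub, mul_assoc]; abel
    rw [this, norm_neg]
    calc _ ≤ ‖g‖ * (‖star v * b * v * a - a‖ * ‖h‖) :=
          (norm_mul_le _ _).trans (by gcongr; exact norm_mul_le _ _)
      _ ≤ 1 * (δ * β⁻¹) := by gcongr
      _ = _ := one_mul _
  have hED : e * D * e = x - e * (star v * b * v) * e := by
    rw [hD, mul_sub, sub_mul, ← mul_assoc e g g, hg, hg, ← hee]
    congr 1
    calc e * (g * (star v * b * v) * g) * e = (e * g) * (star v * b * v) * (g * e) := by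
          simp only [mul_assoc]
      _ = _ := by rw [hg, hge]
  have hsm : ∀ {r s : ℝ}, r ≤ s → r • x ≤ s • x := fun hrs => smul_le_smul_of_nonneg_right hrs hx0
  have I1 : x - e * (star v * b * v) * e ≤ (δ * β⁻¹) • x := by
    have := CStarAlgebra.star_right_conjugate_le_norm_smul (a := e) hDs
    rw [he, hED, hee] at this
    exact this.trans (hsm hDn)
  have I3 : star (v * e) * (v * e) ≤ x := by
    have := CStarAlgebra.star_right_conjugate_le_norm_smul (a := e) (IsSelfAdjoint.star_mul_self v)
    rw [he, hee] at this
    have h1 : ‖star v * v‖ ≤ 1 := by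
      rw [CStarRing.norm_star_mul_self]; nlinarith [norm_nonneg v]
    have h2 := this.trans (hsm h1)
    rw [one_smul] at h2
    simpa only [star_mul, he, mul_assoc] using h2
  have I2 : e * (star v * b * v) * e - e * (star v * cutP b γ * v) * e ≤ γ • x := by
    have := CStarAlgebra.star_left_conjugate_le_norm_smul (a := v * e) hbsa
    have h2 := (this.trans (smul_le_smul_of_nonneg_left I3 (norm_nonneg _))).trans (hsm hbn)
    refine le_of_eq_of_le ?_ h2
    simp only [star_mul, he, mul_assoc, sub_mul, mul_sub]
  have hκ : 0 < 1 - γ - δ * β⁻¹ := by linarith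
  have I4 : (1 - γ - δ * β⁻¹) • x ≤ e * (star v * cutP b γ * v) * e := by
    rw [← sub_nonneg]
    have := add_nonneg (sub_nonneg.2 I1) (sub_nonneg.2 I2)
    refine this.trans_eq ?_
    rw [sub_smul, sub_smul, one_smul]; abel
  have I5 := smul_le_smul_of_nonneg_left I4 (inv_nonneg.2 hκ.le)
  rw [inv_smul_smul₀ hκ.ne'] at I5
  refine aux_cuntz_conj x _ (√((1 - γ - δ * β⁻¹)⁻¹) • (e * star v)) (aux_cuntz_of_le _ _ hx0 ?_)
  refine I5.trans_eq ?_
  rw [star_smul, smul_mul_assoc, smul_mul_assoc, mul_smul_comm, smul_smul, star_trivial (√_),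
    Real.mul_self_sqrt (inv_nonneg.2 hκ.le)]
  simp only [star_mul, star_star, he, mul_assoc]
end

section
/- Let (a_n) be a very rapidly increasing sequence of positive contractions in a C*-algebra A and let 0 < λ < 1. Then for each n and each ε with 0 < ε < λ there exists m₀ such that for all m ≥ m₀ one has (a_n−ε)₊ ≾ (a_m−λ)₊; in particular, (a_n−λ)₊ ≾ (a_m−λ)₊ for all m ≥ m₀. -/
open Filter Topology

variable {A : Type*} [NonUnitalCStarAlgebra A] [PartialOrder A] [StarOrderedRing A]

lemma aux_conj (y f : A) (hy : 0 ≤ y) (hf : star f = f) :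
    0 ≤ y - y * f - f * y + f * y * f := by
  obtain ⟨t, rfl⟩ := CStarAlgebra.nonneg_iff_eq_star_mul_self.mp hy
  have h := star_mul_self_nonneg (t - t * f)
  have e : star (t - t * f) * (t - t * f)
      = star t * t - star t * t * f - f * (star t * t) + f * (star t * t) * f := by
    simp only [star_sub, star_mul, hf]
    noncomm_ring
  rwa [e] at h

lemma aux_fun (s t : ℝ) (hs : 0 < s) (ht : 0 ≤ t) :
    let F := Real.sqrt (t / (t ^ 2 + s ^ 2)) * t * Real.sqrt (t / (t ^ 2 + s ^ 2))
    ‖t - t * F - F * t + F * t * F‖ ≤ s := by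
  intro F
  have hD : 0 < t ^ 2 + s ^ 2 := by positivity
  have hF : F = t ^ 2 / (t ^ 2 + s ^ 2) := by
    have := Real.mul_self_sqrt (show 0 ≤ t / (t ^ 2 + s ^ 2) by positivity)
    calc F = (Real.sqrt (t / (t ^ 2 + s ^ 2)) * Real.sqrt (t / (t ^ 2 + s ^ 2))) * t := by
          simp only [F]; ring
      _ = _ := by rw [this]; ring
  have e : t - t * F - F * t + F * t * F = t * s ^ 4 / (t ^ 2 + s ^ 2) ^ 2 := by
    rw [hF]; field_simp; ring
  rw [e, Real.norm_of_nonneg (by positivity), div_le_iff₀ (by positivity)]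
  have h1 : 0 ≤ s ^ 3 * (s ^ 2 + 2 * t ^ 2 - t * s) := by
    apply mul_nonneg (by positivity)
    nlinarith [sq_nonneg (s - t), sq_nonneg s, sq_nonneg t, mul_nonneg hs.le ht]
  have h2 : 0 ≤ s * t ^ 4 := by positivity
  nlinarith

lemma aux_below (p z : A) (hp : star p = p) (hz : p * p ≤ z) (η : ℝ) (hη : 0 < η) :
    ∃ w : A, ‖w * z * star w - p * p‖ ≤ η := by
  have hpp : 0 ≤ p * p := by simpa [hp] using star_mul_self_nonneg p
  have hz0 : 0 ≤ z := hpp.trans hz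
  have hzs : IsSelfAdjoint z := .of_nonneg hz0
  set B := ‖p‖ + 1 with hB
  have hB0 : 0 < B := by positivity
  set s := (η / B) ^ 2 with hsdef
  have hs : 0 < s := by positivity
  let G : ℝ → ℝ := fun t => Real.sqrt (t / (t ^ 2 + s ^ 2))
  have hGc : Continuous G := by
    apply Continuous.sqrt
    exact continuous_id.div (by fun_prop) (fun t => by positivity)
  have hG0 : G 0 = 0 := by simp [G]
  let F : ℝ → ℝ := fun t => G t * t * G t
  have hFc : Continuous F := by fun_prop
  have hF0 : F 0 = 0 := by simp [F]
  set g := cfcₙ G z with hg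
  set f := cfcₙ F z with hf
  have hgs : star g = g := (cfcₙ_predicate (p := IsSelfAdjoint) G z).star_eq
  have hfs : star f = f := (cfcₙ_predicate (p := IsSelfAdjoint) F z).star_eq
  have hid : cfcₙ (fun t : ℝ => t) z = z := cfcₙ_id' ℝ z
  have hfg : f = g * z * g := by
    have e1 : cfcₙ (fun t => G t * t) z = g * z := by
      rw [cfcₙ_mul G (fun t => t) z hGc.continuousOn hG0 (by fun_prop) rfl, hid]
    rw [hf, ← e1]
    exact cfcₙ_mul (fun t => G t * t) G z (by fun_prop) (by simp) hGc.continuousOn hG0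
  have hH : cfcₙ (fun t => t - t * F t - F t * t + F t * t * F t) z
      = z - z * f - f * z + f * z * f := by
    rw [cfcₙ_add (fun t => t - t * F t - F t * t) (fun t => F t * t * F t) z
        (by fun_prop) (by simp) (by fun_prop) (by simp),
      cfcₙ_sub (fun t => t - t * F t) (fun t => F t * t) z
        (by fun_prop) (by simp) (by fun_prop) (by simp),
      cfcₙ_sub (fun t => t) (fun t => t * F t) z
        (by fun_prop) (by simp) (by fun_prop) (by simp),
      cfcₙ_mul (fun t => F t * t) F z (by fun_prop) (by simp) (by fun_prop) hF0,
      cfcₙ_mul F (fun t => t) z (by fun_prop) hF0 (by fun_prop) rfl,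
      cfcₙ_mul (fun t => t) F z (by fun_prop) rfl (by fun_prop) hF0, hid]
  have hHn : ‖z - z * f - f * z + f * z * f‖ ≤ s := by
    rw [← hH]
    exact norm_cfcₙ_le fun t ht => aux_fun s t hs (quasispectrum_nonneg_of_nonneg z hz0 t ht)
  have hr : ‖p - p * f‖ ≤ η / B := by
    have e : star (p - p * f) * (p - p * f)
        = p * p - p * p * f - f * (p * p) + f * (p * p) * f := by
      simp only [star_sub, star_mul, hfs, hp]
      noncomm_ring
    have hle : star (p - p * f) * (p - p * f) ≤ z - z * f - f * z + f * z * f := by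
      rw [e, ← sub_nonneg]
      have := aux_conj (z - p * p) f (sub_nonneg.mpr hz) hfs
      convert this using 1
      noncomm_ring
    have h2 := CStarAlgebra.norm_le_norm_of_nonneg_of_le (star_mul_self_nonneg _) hle
    rw [CStarRing.norm_star_mul_self] at h2
    have h3 : ‖p - p * f‖ ^ 2 ≤ (η / B) ^ 2 := by
      rw [sq]; exact h2.trans hHn
    exact le_of_sq_le_sq h3 (by positivity)
  refine ⟨p * g, ?_⟩
  have e : p * g * z * star (p * g) - p * p = - ((p - p * f) * p) := by
    rw [star_mul, hgs, hp, hfg]; noncomm_ring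
  rw [e, norm_neg]
  calc ‖(p - p * f) * p‖ ≤ ‖p - p * f‖ * ‖p‖ := norm_mul_le _ _
    _ ≤ η / B * B := by gcongr; simp [hB]
    _ = η := by field_simp

lemma aux_main (x b v : A) (hx : 0 ≤ x) (hx1 : ‖x‖ ≤ 1) (hb : 0 ≤ b) (lam : ℝ)
    (hl0 : 0 < lam) (hl1 : lam < 1) (ε : ℝ) (hε : 0 < ε) (hv : ‖v‖ ≤ 1)
    (hvx : ‖v * b * star v * x - x‖ < ε ^ 2 * ((1 - lam) / 2)) :
    CuntzBelow (cutP x ε) (cutP b lam) := by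
  have hxs : IsSelfAdjoint x := .of_nonneg hx
  have hbs : IsSelfAdjoint b := .of_nonneg hb
  let P : ℝ → ℝ := fun t => Real.sqrt (max (t - ε) 0)
  let H : ℝ → ℝ := fun t => t / (max t ε) ^ 2
  have hm : ∀ t : ℝ, 0 < max t ε := fun t => lt_max_of_lt_right hε
  have hPc : Continuous P := by fun_prop
  have hP0 : P 0 = 0 := by simp [P, hε.le]
  have hHc : Continuous H := 
    continuous_id.div (by fun_prop) (fun t => (pow_pos (hm t) 2).ne')
  have hH0 : H 0 = 0 := by simp [H]
  set p := cfcₙ P x with hpdef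
  set h := cfcₙ H x with hhdef
  have hps : star p = p := (cfcₙ_predicate (p := IsSelfAdjoint) P x).star_eq
  have hhs : star h = h := (cfcₙ_predicate (p := IsSelfAdjoint) H x).star_eq
  have hid : cfcₙ (fun t : ℝ => t) x = x := cfcₙ_id' ℝ x
  have hpp : cutP x ε = p * p := by
    rw [hpdef, ← cfcₙ_mul P P x hPc.continuousOn hP0 hPc.continuousOn hP0]
    exact cfcₙ_congr fun t _ => (Real.mul_self_sqrt (le_max_right _ _)).symm
  have hphx : p * h * x = p := by
    conv_lhs => rw [← hid]
    rw [hpdef, hhdef, hid, ← cfcₙ_mul P H x hPc.continuousOn hP0 hHc.continuousOn hH0]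
    conv_lhs => rw [← hid]
    rw [hid]
    nth_rw 2 [← hid]
    rw [← cfcₙ_mul (fun t => P t * H t) (fun t => t) x (by fun_prop) (by simp [hP0])
      (by fun_prop) rfl]
    refine cfcₙ_congr fun t _ => ?_
    simp only [P, H]
    rcases le_total t ε with h1 | h1
    · simp [max_eq_right (sub_nonpos.mpr h1)]
    · rw [max_eq_left h1]
      have : 0 < t := hε.trans_le h1
      field_simp
  have hxhp : x * h * p = p := by
    have := congrArg star hphx
    simpa [star_mul, hps, hhs, hxs.star_eq, mul_assoc] using this
  have hhn : ‖h‖ ≤ 1 / ε := by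
    refine norm_cfcₙ_le fun t ht => ?_
    have ht0 := quasispectrum_nonneg_of_nonneg x hx t ht
    rw [Real.norm_of_nonneg (by positivity), div_le_div_iff₀ (pow_pos (hm t) 2) hε]
    have h1 := le_max_left t ε
    have h2 := le_max_right t ε
    nlinarith [mul_le_mul h1 h2 hε.le (hm t).le]
  set c := v * b * star v with hc
  have hcs : star c = c := by simp [hc, star_mul, hbs.star_eq, mul_assoc]
  set κ := (1 - lam) / 2 with hκ
  have hκ0 : 0 < κ := by rw [hκ]; linarith
  set k := h * (x * x - x * c * x) * h with hk
  have hks : IsSelfAdjoint k := by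
    show star k = k
    simp only [hk, star_mul, star_sub, hhs, hcs, hxs.star_eq, mul_assoc]
  have hkn : ‖k‖ ≤ κ := by
    have e : k = - (h * (x * (c * x - x)) * h) := by rw [hk]; noncomm_ring
    rw [e, norm_neg]
    calc ‖h * (x * (c * x - x)) * h‖ ≤ ‖h‖ * (‖x‖ * ‖c * x - x‖) * ‖h‖ := by
          refine (norm_mul_le _ _).trans ?_
          gcongr
          refine (norm_mul_le _ _).trans ?_
          gcongr
          exact norm_mul_le _ _
      _ ≤ 1 / ε * (1 * (ε ^ 2 * κ)) * (1 / ε) := by gcongr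
      _ = κ := by field_simp
  have hppn : 0 ≤ p * p := by simpa [hps] using star_mul_self_nonneg p
  have h1 : p * p - p * c * p ≤ κ • (p * p) := by
    have e : p * p - p * c * p = star p * k * p := by
      rw [hps]
      calc p * p - p * c * p = (p * h * x) * (x * h * p) - (p * h * x) * c * (x * h * p) := by
            rw [hphx, hxhp]
        _ = _ := by rw [hk]; noncomm_ring
    rw [e]
    refine (CStarAlgebra.star_left_conjugate_le_norm_smul hks).trans ?_
    rw [hps]
    exact smul_le_smul_of_nonneg_right hkn hppn
  set d := cutP b lam with hd
  set q := cfcₙ (fun t : ℝ => min t lam) b with hq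
  have hqs : IsSelfAdjoint q := cfcₙ_predicate (p := IsSelfAdjoint) _ b
  have hbdq : b = d + q := by
    rw [hd, hq, cutP, ← cfcₙ_add (fun t : ℝ => max (t - lam) 0) (fun t : ℝ => min t lam) b
      (by fun_prop) (by simp [hl0.le]) (by fun_prop) (by simp [hl0.le])]
    conv_lhs => rw [← cfcₙ_id' ℝ b]
    refine cfcₙ_congr fun t _ => ?_
    rcases le_total t lam with h1 | h1
    · simp [h1]
    · simp [h1]
  have hqn : ‖q‖ ≤ lam := by
    refine norm_cfcₙ_le fun t ht => ?_
    have ht0 := quasispectrum_nonneg_of_nonneg b hb t ht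
    rw [Real.norm_of_nonneg (le_min ht0 hl0.le)]
    exact min_le_right _ _
  have hvv : p * (v * star v) * p ≤ p * p := by
    have := CStarAlgebra.star_left_conjugate_le_norm_smul (a := p)
      (IsSelfAdjoint.mul_star_self v)
    rw [hps] at this
    refine this.trans ?_
    have hn : ‖v * star v‖ ≤ 1 := by
      rw [CStarRing.norm_self_mul_star]; nlinarith [norm_nonneg v]
    simpa using smul_le_smul_of_nonneg_right hn hppn
  have hvvn : 0 ≤ p * (v * star v) * p := by
    have := mul_star_self_nonneg (p * v)
    simpa [star_mul, hps, mul_assoc] using this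
  have h2 : (p * v) * q * star (p * v) ≤ lam • (p * p) := by
    refine (CStarAlgebra.star_right_conjugate_le_norm_smul hqs).trans ?_
    have e : p * v * star (p * v) = p * (v * star v) * p := by
      simp [star_mul, hps, mul_assoc]
    rw [e]
    exact (smul_le_smul_of_nonneg_right hqn hvvn).trans (smul_le_smul_of_nonneg_left hvv hl0.le)
  set y := (p * v) * d * star (p * v) with hy
  have h3 : p * c * p = y + (p * v) * q * star (p * v) := by
    rw [hc, hy]
    nth_rw 1 [hbdq]
    rw [star_mul, hps]
    noncomm_ring
  have h4 : κ • (p * p) ≤ y := by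
    rw [h3] at h1
    have h5 := add_le_add h1 h2
    have e : κ • (p * p) = p * p - (κ • (p * p) + lam • (p * p)) := by
      have : κ = 1 - (κ + lam) := by rw [hκ]; ring
      nth_rw 1 [this]
      rw [sub_smul, one_smul, add_smul]
    rw [e, sub_le_iff_le_add]
    have h6 : p * p - (y + p * v * q * star (p * v)) + p * v * q * star (p * v) = p * p - y := by
      abel
    rw [h6] at h5
    rw [add_comm]
    exact sub_le_iff_le_add.mp h5
  have h5 : p * p ≤ κ⁻¹ • y := by
    have := smul_le_smul_of_nonneg_left h4 (inv_nonneg.mpr hκ0.le)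
    rwa [smul_smul, inv_mul_cancel₀ hκ0.ne', one_smul] at this
  have hw : ∀ n : ℕ, ∃ w : A, ‖w * (κ⁻¹ • y) * star w - p * p‖ ≤ 1 / ((n : ℝ) + 1) :=
    fun n => aux_below p _ hps h5 _ (by positivity)
  choose w hw using hw
  refine ⟨fun n => Real.sqrt κ⁻¹ • (w n * (p * v)), ?_⟩
  refine squeeze_zero (fun n => norm_nonneg _) (fun n => ?_)
    (tendsto_one_div_add_atTop_nhds_zero_nat (𝕜 := ℝ))
  convert hw n using 2
  rw [hpp]
  congr 1
  have hsq := Real.mul_self_sqrt (inv_nonneg.mpr hκ0.le)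
  simp only [star_smul, star_trivial, smul_mul_assoc, mul_smul_comm, smul_smul, hsq]
  rw [hy]
  simp only [star_mul, mul_assoc]

theorem stmt2 (a : ℕ → A) (hpos : ∀ n, 0 ≤ a n) (hnorm : ∀ n, ‖a n‖ ≤ 1)
    (hvri : VeryRapidlyIncreasing a) (lam : ℝ) (hlam0 : 0 < lam) (hlam1 : lam < 1) :
    ∀ n : ℕ, ∀ ε : ℝ, 0 < ε → ε < lam →
      ∃ m₀, ∀ m ≥ m₀,
        CuntzBelow (cutP (a n) ε) (cutP (a m) lam) ∧
        CuntzBelow (cutP (a n) lam) (cutP (a m) lam) := by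
  intro n ε hε hεl
  have key : ∀ ε : ℝ, 0 < ε → ∃ m₀, ∀ m ≥ m₀, CuntzBelow (cutP (a n) ε) (cutP (a m) lam) := by
    intro ε hε
    obtain ⟨m₀, h⟩ := hvri.2 (ε ^ 2 * ((1 - lam) / 2))
      (mul_pos (by positivity) (by linarith)) n
    refine ⟨m₀, fun m hm => ?_⟩
    obtain ⟨v, hv, hvx⟩ := h m hm
    exact aux_main (a n) (a m) v (hpos n) (hnorm n) (hpos m) lam hlam0 hlam1 ε hε hv hvx
  obtain ⟨m₁, h₁⟩ := key ε hε
  obtain ⟨m₂, h₂⟩ := key lam hlam0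
  exact ⟨max m₁ m₂, fun m hm => ⟨h₁ m (le_of_max_le_left hm), h₂ m (le_of_max_le_right hm)⟩⟩
end

section
/- Let A be a C*-algebra and let a, b be positive contractions in A with a ≾ b. Then for every ε > 0 there exists v ∈ A such that ‖v* b v a − a‖ ≤ ε and ‖v* b v‖ ≤ 1. -/
open Filter Topology

variable {A : Type*} [NonUnitalCStarAlgebra A] [PartialOrder A] [StarOrderedRing A]

theorem stmt3 (a b : A) (ha : 0 ≤ a) (ha1 : ‖a‖ ≤ 1) (hb : 0 ≤ b) (hb1 : ‖b‖ ≤ 1)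
    (hab : CuntzBelow a b) :
    ∀ ε : ℝ, 0 < ε → ∃ v : A, ‖star v * b * v * a - a‖ ≤ ε ∧ ‖star v * b * v‖ ≤ 1 := by
  intro ε hε
  obtain ⟨v, hv⟩ := hab
  have hv' : Tendsto (fun n => v n * b * star (v n)) atTop (𝓝 a) :=
    tendsto_iff_norm_sub_tendsto_zero.2 hv
  obtain ⟨δ, hδ, hδε⟩ : ∃ δ : ℝ, 0 < δ ∧ 2 * δ < ε := ⟨ε / 4, by linarith, by linarith⟩
  have hsa : IsSelfAdjoint a := .of_nonneg ha
  let g : ℝ → ℝ := fun t => Real.sqrt t / (|t| + δ)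
  have hgc : Continuous g := by
    refine Continuous.div (by fun_prop) (by fun_prop) (fun t => ?_)
    positivity
  have hg0 : g 0 = 0 := by simp [g]
  have hspec : ∀ t ∈ quasispectrum ℝ a, 0 ≤ t ∧ t ≤ 1 := fun t ht =>
    ⟨quasispectrum_nonneg_of_nonneg a ha t ht,
      (le_abs_self t).trans
        ((NonUnitalIsometricContinuousFunctionalCalculus.norm_quasispectrum_le a ht hsa).trans ha1)⟩
  set G : A := cfcₙ g a with hG
  have hGs : star G = G := (cfcₙ_predicate g a : IsSelfAdjoint G)
  have e1 : G * a * G = cfcₙ (fun t => g t * t * g t) a := by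
    have h1 := cfcₙ_mul g (fun t : ℝ => t) a hgc.continuousOn hg0
    have h2 := cfcₙ_mul (fun t => g t * t) g a (by fun_prop) (by simp) hgc.continuousOn hg0
    rw [h2, h1, cfcₙ_id' ℝ a]
  have e2 : G * a * G * a - a = cfcₙ (fun t => g t * t * g t * t - t) a := by
    have h1 := cfcₙ_mul (fun t => g t * t * g t) (fun t : ℝ => t) a (by fun_prop) (by simp)
    have h2 := cfcₙ_sub (fun t => g t * t * g t * t) (fun t : ℝ => t) a (by fun_prop) (by simp)
    rw [h2, h1, cfcₙ_id' ℝ a, e1]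
  have key : ∀ t : ℝ, 0 ≤ t → g t * t * g t = (t / (t + δ)) ^ 2 := fun t ht => by
    have := Real.mul_self_sqrt ht
    simp only [g, abs_of_nonneg ht]
    have h3 : t + δ ≠ 0 := by positivity
    field_simp
    rw [pow_two (Real.sqrt t), this]; ring
  have n1 : ‖G * a * G‖ < 1 := by
    rw [e1]
    refine lt_of_le_of_lt (norm_cfcₙ_le (c := 1 / (1 + δ)) fun t ht => ?_) ?_
    · obtain ⟨h0, h1⟩ := hspec t ht
      rw [key t h0, Real.norm_of_nonneg (by positivity)]
      have h5 : t / (t + δ) ≤ 1 / (1 + δ) := by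
        rw [div_le_div_iff₀ (by positivity) (by positivity)]; nlinarith
      have h6 : 0 ≤ t / (t + δ) := by positivity
      have h7 : 1 / (1 + δ) ≤ 1 := by rw [div_le_one (by positivity)]; linarith
      nlinarith
    · rw [div_lt_one (by positivity)]; linarith
  have n2 : ‖G * a * G * a - a‖ < ε := by
    rw [e2]
    refine lt_of_le_of_lt (norm_cfcₙ_le (c := 2 * δ) fun t ht => ?_) hδε
    obtain ⟨h0, h1⟩ := hspec t ht
    rw [key t h0]
    have h6 : 0 ≤ t / (t + δ) := by positivity
    have h7 : t / (t + δ) ≤ 1 := by rw [div_le_one (by positivity)]; linarith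
    have h8 : t - t / (t + δ) * t = δ * (t / (t + δ)) := by
      have h3 : t + δ ≠ 0 := by positivity
      field_simp; ring
    rw [Real.norm_eq_abs, abs_le]
    constructor
    · nlinarith [mul_nonneg hδ.le h6]
    · nlinarith [mul_nonneg hδ.le h6]
  have t1 : Tendsto (fun n => G * (v n * b * star (v n)) * G) atTop (𝓝 (G * a * G)) :=
    (hv'.const_mul G).mul_const G
  have t2 := ((t1.mul_const a).sub_const a).norm
  obtain ⟨n, hn1, hn2⟩ := ((t1.norm.eventually_lt_const n1).and
    (t2.eventually_lt_const n2)).exists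
  have e3 : star (star (v n) * G) * b * (star (v n) * G) = G * (v n * b * star (v n)) * G := by
    simp only [star_mul, star_star, hGs, mul_assoc]
  exact ⟨star (v n) * G, by rw [e3]; exact hn2.le, by rw [e3]; exact hn1.le⟩
end

section
/- Let (a_n) be a very rapidly increasing sequence of positive contractions in a C*-algebra A, and let a be a positive contraction in A such that a ≾ a_{m₁} for some index m₁. Then for every ε > 0 there exists m₀ such that for all m ≥ m₀ there is a contraction v ∈ A with ‖(v* a_m v) a − a‖ < ε. -/
open Filter Topology

variable {A : Type*} [NonUnitalCStarAlgebra A] [PartialOrder A] [StarOrderedRing A]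

theorem exists_w (b c : A) (hb : 0 ≤ b) (hc1 : ‖c‖ ≤ 1) (hle : CuntzBelow c b) (η : ℝ) (hη : 0 < η) :
    ∃ s y : A, star s = s ∧ s * s = b ∧ ‖s * y‖ ≤ 1 ∧
      ‖star (s * y) * (s * y) * c - c‖ ≤ 4 * η := by
  obtain ⟨x, hx⟩ := hle
  obtain ⟨n, hn⟩ := (hx.eventually (gt_mem_nhds hη)).exists
  set s := CFC.sqrt b
  have hs0 : 0 ≤ s := CFC.sqrt_nonneg b
  have hs : star s = s := (IsSelfAdjoint.of_nonneg hs0).star_eq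
  have hss : s * s = b := CFC.sqrt_mul_sqrt_self b hb
  set d := x n * b * star (x n) with hd
  have hdz : d = star (s * star (x n)) * (s * star (x n)) := by
    rw [hd, star_mul, star_star, hs, ← hss]; simp only [mul_assoc]
  have hd0 : 0 ≤ d := by rw [hdz]; exact star_mul_self_nonneg _
  have hdsa : IsSelfAdjoint d := IsSelfAdjoint.of_nonneg hd0
  set g : ℝ → ℝ := fun t => Real.sqrt t / (|t| + η) with hg
  have hne : ∀ t : ℝ, |t| + η ≠ 0 := fun t => by positivity
  have hgc : Continuous g := by
    apply Continuous.div _ _ hne <;> fun_prop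
  have hg0 : g 0 = 0 := by simp [hg]
  set h : ℝ → ℝ := fun t => g t * t * g t with hh
  have hhc : Continuous h := by fun_prop
  have hh0 : h 0 = 0 := by simp [hh]
  have hval : ∀ t : ℝ, 0 ≤ t → h t = t ^ 2 / (t + η) ^ 2 := by
    intro t ht
    have : Real.sqrt t * Real.sqrt t = t := Real.mul_self_sqrt ht
    have h2 : t + η ≠ 0 := by positivity
    simp only [hh, hg, abs_of_nonneg ht]
    field_simp
    nlinarith
  have hsp : ∀ t ∈ quasispectrum ℝ d, 0 ≤ t := fun t ht => quasispectrum_nonneg_of_nonneg d hd0 t ht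
  set G := cfcₙ g d
  have hGs : star G = G := (cfcₙ_predicate g d : IsSelfAdjoint G).star_eq
  have hid : cfcₙ (fun t : ℝ => t) d = d := cfcₙ_id' ℝ d
  have hH : G * d * G = cfcₙ h d := by
    rw [hh, cfcₙ_mul (fun t => g t * t) g d (by fun_prop) (by simp) (by fun_prop) hg0,
      cfcₙ_mul g (fun t => t) d (by fun_prop) hg0 (by fun_prop) rfl, hid]
  have hww : star (s * (star (x n) * G)) * (s * (star (x n) * G)) = cfcₙ h d := by
    rw [← hH, hdz]
    simp only [star_mul, star_star, hGs, mul_assoc]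
  have hH1 : ‖cfcₙ h d‖ ≤ 1 := by
    apply norm_cfcₙ_le
    intro t ht
    have ht := hsp t ht
    rw [hval t ht, Real.norm_of_nonneg (by positivity), div_le_one (by positivity)]
    nlinarith
  have hHd : ‖cfcₙ h d * d - d‖ ≤ 2 * η := by
    have : cfcₙ h d * d - d = cfcₙ (fun t => h t * t - t) d := by
      rw [cfcₙ_sub (fun t => h t * t) (fun t => t) d (by fun_prop) (by simp) (by fun_prop) rfl,
        cfcₙ_mul h (fun t => t) d (by fun_prop) hh0 (by fun_prop) rfl, hid]
    rw [this]
    apply norm_cfcₙ_le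
    intro t ht
    have ht := hsp t ht
    rw [hval t ht, Real.norm_eq_abs, abs_le]
    have hp : 0 < (t + η) ^ 2 := by positivity
    have e : t ^ 2 / (t + η) ^ 2 * t - t = - (t * (2 * t * η + η ^ 2) / (t + η) ^ 2) := by
      field_simp; ring
    rw [e]
    have h1 : t * (2 * t * η + η ^ 2) / (t + η) ^ 2 ≤ 2 * η := by
      rw [div_le_iff₀ hp]
      have : 0 ≤ t * η ^ 2 := by positivity
      have : 0 ≤ η ^ 3 := by positivity
      nlinarith
    have h2 : 0 ≤ t * (2 * t * η + η ^ 2) / (t + η) ^ 2 := by positivity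
    constructor <;> linarith
  refine ⟨s, star (x n) * G, hs, hss, ?_, ?_⟩
  · have := CStarRing.norm_star_mul_self (x := s * (star (x n) * G))
    rw [hww] at this
    nlinarith [norm_nonneg (s * (star (x n) * G))]
  · rw [hww]
    have e : cfcₙ h d * c - c = (cfcₙ h d * d - d) - cfcₙ h d * (d - c) + (d - c) := by
      rw [mul_sub]; abel
    rw [e]
    have h1 : ‖cfcₙ h d * (d - c)‖ ≤ η :=
      (norm_mul_le _ _).trans (by nlinarith [norm_nonneg (d - c), norm_nonneg (cfcₙ h d)])
    have h2 := norm_add_le ((cfcₙ h d * d - d) - cfcₙ h d * (d - c)) (d - c)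
    have h3 := norm_sub_le (cfcₙ h d * d - d) (cfcₙ h d * (d - c))
    linarith

theorem stmt4 (a : ℕ → A) (hpos : ∀ n, 0 ≤ a n) (hnorm : ∀ n, ‖a n‖ ≤ 1)
    (hvri : VeryRapidlyIncreasing a)
    (c : A) (hc : 0 ≤ c) (hc1 : ‖c‖ ≤ 1) (m₁ : ℕ) (hle : CuntzBelow c (a m₁)) :
    ∀ ε : ℝ, 0 < ε → ∃ m₀, ∀ m ≥ m₀,
      ∃ v : A, ‖v‖ ≤ 1 ∧ ‖star v * a m * v * c - c‖ < ε := by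
  intro ε hε
  obtain ⟨s, y, hs, hss, hw, hwc⟩ := exists_w (a m₁) c (hpos m₁) hc1 hle (ε / 8) (by positivity)
  set κ : ℝ := ε / (4 * (‖y‖ + 1)) with hκ
  have hκ0 : 0 < κ := by positivity
  obtain ⟨m₀, hm₀⟩ := hvri.2 (κ ^ 2 / 2) (by positivity) m₁
  refine ⟨m₀, fun m hm => ?_⟩
  obtain ⟨v, hv, hvb⟩ := hm₀ m hm
  set T := v * a m * star v with hT
  have hsv : ‖star v‖ ≤ 1 := by rwa [norm_star]
  have hT1 : ‖T‖ ≤ 1 := by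
    have h1 : ‖v * a m‖ ≤ 1 := (norm_mul_le _ _).trans (mul_le_one₀ hv (norm_nonneg _) (hnorm m))
    exact (norm_mul_le _ _).trans (mul_le_one₀ h1 (norm_nonneg _) hsv)
  have hTs : star T = T := by
    rw [hT]; simp only [star_mul, star_star, (IsSelfAdjoint.of_nonneg (hpos m)).star_eq, mul_assoc]
  have hE : ‖T * s - s‖ ≤ κ := by
    have h0 := CStarRing.norm_self_mul_star (x := T * s - s)
    have e : (T * s - s) * star (T * s - s) = (T * a m₁ - a m₁) * T - (T * a m₁ - a m₁) := by
      rw [star_sub, star_mul, hs, hTs, ← hss]; noncomm_ring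
    rw [e] at h0
    have h1 := norm_sub_le ((T * a m₁ - a m₁) * T) (T * a m₁ - a m₁)
    have h2 := norm_mul_le (T * a m₁ - a m₁) T
    have h3 : ‖T * a m₁ - a m₁‖ * ‖T‖ ≤ ‖T * a m₁ - a m₁‖ :=
      mul_le_of_le_one_right (norm_nonneg _) hT1
    refine le_of_not_gt (fun hlt => ?_)
    nlinarith
  have hTw : ‖T * (s * y) - s * y‖ ≤ ε / 4 := by
    have e : T * (s * y) - s * y = (T * s - s) * y := by noncomm_ring
    rw [e]
    refine (norm_mul_le _ _).trans ((mul_le_mul_of_nonneg_right hE (norm_nonneg _)).trans ?_)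
    have : κ * (‖y‖ + 1) = ε / 4 := by rw [hκ]; field_simp
    nlinarith
  set w := s * y with hwdef
  refine ⟨star v * w, (norm_mul_le _ _).trans (mul_le_one₀ hsv (norm_nonneg _) hw), ?_⟩
  have e : star (star v * w) * a m * (star v * w) * c - c
      = star w * (T * w - w) * c + (star w * w * c - c) := by
    rw [hT, star_mul, star_star]; noncomm_ring
  rw [e]
  have h1 : ‖star w * (T * w - w)‖ ≤ ε / 4 := by
    refine (norm_mul_le _ _).trans ?_
    rw [norm_star]
    nlinarith [norm_nonneg w, norm_nonneg (T * w - w)]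
  have h2 : ‖star w * (T * w - w) * c‖ ≤ ε / 4 :=
    (norm_mul_le _ _).trans (by
      nlinarith [norm_nonneg c, norm_nonneg (star w * (T * w - w))])
  have h3 := norm_add_le (star w * (T * w - w) * c) (star w * w * c - c)
  linarith
end

section
/- Let (a_n) and (a'_n) be very rapidly increasing sequences of positive contractions in a C*-algebra A such that for every n there is m with a_n ≾ a'_m, and for every n there is m with a'_n ≾ a_m. Then there exist strictly increasing sequences of indices m₁ < m₂ < ⋯ and n₁ < n₂ < ⋯ such that the interleaved sequence (a_{m₁}, a'_{n₁}, a_{m₂}, a'_{n₂}, …) is very rapidly increasing. -/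
open Filter Topology

variable {A : Type*} [NonUnitalCStarAlgebra A] [PartialOrder A] [StarOrderedRing A]

lemma cuntz_approx {a b : A} (h : CuntzBelow a b) {ε : ℝ} (hε : 0 < ε) :
    ∃ v : A, ‖v * b * star v - a‖ < ε := by
  obtain ⟨v, hv⟩ := h
  obtain ⟨n, hn⟩ := (hv.eventually (gt_mem_nhds hε)).exists
  exact ⟨v n, hn⟩

lemma cuntz_of_approx {a b : A} (h : ∀ ε > (0 : ℝ), ∃ v : A, ‖v * b * star v - a‖ < ε) :
    CuntzBelow a b := by
  choose v hv using fun n : ℕ => h (1 / ((n : ℝ) + 1)) (by positivity)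
  exact ⟨v, squeeze_zero (fun _ => norm_nonneg _) (fun n => (hv n).le)
    tendsto_one_div_add_atTop_nhds_zero_nat⟩

lemma cuntz_trans {a b c : A} (h1 : CuntzBelow a b) (h2 : CuntzBelow b c) :
    CuntzBelow a c := by
  apply cuntz_of_approx
  intro ε hε
  obtain ⟨v, hv⟩ := cuntz_approx h1 (half_pos hε)
  obtain ⟨w, hw⟩ := cuntz_approx h2 (ε := ε / 2 / (‖v‖ * ‖v‖ + 1)) (by positivity)
  refine ⟨v * w, ?_⟩
  have e : v * w * c * star (v * w) - a
      = v * (w * c * star w - b) * star v + (v * b * star v - a) := by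
    simp only [star_mul, mul_sub, sub_mul, mul_assoc]; abel
  have h3 : ‖v * (w * c * star w - b) * star v‖ ≤ ε / 2 := by
    calc _ ≤ ‖v‖ * ‖w * c * star w - b‖ * ‖v‖ := by
          refine (norm_mul_le _ _).trans ?_
          rw [norm_star]; gcongr; exact norm_mul_le _ _
      _ = (‖v‖ * ‖v‖) * ‖w * c * star w - b‖ := by ring
      _ ≤ (‖v‖ * ‖v‖ + 1) * (ε / 2 / (‖v‖ * ‖v‖ + 1)) := by gcongr; linarith
      _ = ε / 2 := by field_simp
  rw [e]
  linarith [norm_add_le (v * (w * c * star w - b) * star v) (v * b * star v - a)]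

lemma cut_below {b : A} (hb : 0 ≤ b) {ε : ℝ} (hε : 0 < ε) : CuntzBelow (cutP b ε) b := by
  have hsa : IsSelfAdjoint b := IsSelfAdjoint.of_nonneg hb
  let f : ℝ → ℝ := fun t => Real.sqrt (max (t - ε) 0 / max t ε)
  have hm : ∀ t : ℝ, 0 < max t ε := fun t => lt_max_of_lt_right hε
  have hfc : Continuous f := by
    apply Continuous.sqrt
    exact Continuous.div (by fun_prop) (by fun_prop) (fun t => (hm t).ne')
  have hf0 : f 0 = 0 := by
    simp only [f]; rw [max_eq_right (by linarith)]; simp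
  have key : cfcₙ f b * b * star (cfcₙ f b) = cutP b ε := by
    have hs : IsSelfAdjoint (cfcₙ f b) := cfcₙ_predicate f b
    rw [hs.star_eq]
    have h1 : cfcₙ f b * b = cfcₙ (fun t => f t * t) b := by
      nth_rewrite 2 [← cfcₙ_id' ℝ b hsa]
      rw [← cfcₙ_mul f (fun t => t) b hfc.continuousOn hf0 continuousOn_id rfl]
    rw [h1, ← cfcₙ_mul (fun t => f t * t) f b (by fun_prop) (by simp) hfc.continuousOn hf0]
    unfold cutP
    congr 1
    ext t
    have h0 : 0 ≤ max (t - ε) 0 / max t ε := div_nonneg (le_max_right _ _) (hm t).le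
    have : f t * t * f t = max (t - ε) 0 / max t ε * t := by
      have := Real.mul_self_sqrt h0
      simp only [f]; linear_combination t * this
    rw [this]
    rcases le_total t ε with h | h
    · rw [max_eq_right (a := t - ε) (by linarith)]; simp
    · rw [max_eq_left h]
      have : t ≠ 0 := by linarith
      field_simp
  exact cuntz_of_approx fun δ hδ => ⟨cfcₙ f b, by rw [key]; simpa using hδ⟩

lemma cut_step {x : A} {b : ℕ → A} (hb : ∀ n, 0 ≤ b n) (hr : RapidlyIncreasing b) {k : ℕ}
    (h : CuntzBelow x (b k)) :
    ∀ m ≥ k + 1, ∃ ε > (0 : ℝ), CuntzBelow x (cutP (b m) ε) := by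
  intro m hm
  induction m, hm using Nat.le_induction with
  | base =>
    obtain ⟨ε, hε, h1⟩ := hr k
    exact ⟨ε, hε, cuntz_trans h h1⟩
  | succ m hm ih =>
    obtain ⟨ε, hε, h1⟩ := ih
    obtain ⟨ε', hε', h2⟩ := hr m
    exact ⟨ε', hε', cuntz_trans (cuntz_trans h1 (cut_below (hb m) hε)) h2⟩

/-- Key approximation step. -/
lemma approx_step {q : A} (hq : ‖q‖ ≤ 1) {b : ℕ → A} (hb : ∀ n, 0 ≤ b n)
    (hbn : ∀ n, ‖b n‖ ≤ 1) (hv : VeryRapidlyIncreasing b) {k : ℕ} (h : CuntzBelow q (b k))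
    {δ : ℝ} (hδ : 0 < δ) :
    ∃ l₀, ∀ l ≥ l₀, ∃ y : A, ‖y‖ ≤ 1 ∧ ‖y * b l * star y - q‖ < δ := by
  obtain ⟨w, hw⟩ := cuntz_approx h (ε := δ / 4) (by positivity)
  obtain ⟨c, hcs, hcc⟩ : ∃ c : A, star c = c ∧ c * c = b k :=
    ⟨CFC.sqrt (b k), (IsSelfAdjoint.of_nonneg (CFC.sqrt_nonneg _)).star_eq,
      CFC.sqrt_mul_sqrt_self (b k) (hb k)⟩
  set θ : ℝ := δ / 4 / (‖w‖ + 1) with hθ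
  have hθ0 : 0 < θ := by positivity
  obtain ⟨l₀, hl₀⟩ := hv.2 (θ ^ 2 / 2) (by positivity) k
  refine ⟨l₀, fun l hl => ?_⟩
  obtain ⟨v, hv1, hv2⟩ := hl₀ l hl
  set u := v * b l * star v with hu
  have hus : star u = u := by
    simp only [hu, star_mul, star_star, (IsSelfAdjoint.of_nonneg (hb l)).star_eq, mul_assoc]
  have hun : ‖u‖ ≤ 1 := by
    calc ‖u‖ ≤ ‖v‖ * ‖b l‖ * ‖v‖ := by
          refine (norm_mul_le _ _).trans ?_
          rw [norm_star]; gcongr; exact norm_mul_le _ _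
      _ ≤ 1 * 1 * 1 := by gcongr; exact hbn l
      _ = 1 := by norm_num
  -- `u` almost fixes `c`
  have hd : ‖u * c - c‖ ≤ θ := by
    have e : (u * c - c) * star (u * c - c) = (u * b k - b k) * u - (u * b k - b k) := by
      simp only [star_sub, star_mul, hus, hcs, ← hcc, mul_sub, sub_mul, mul_assoc]
    have h1 : ‖u * c - c‖ * ‖u * c - c‖ ≤ θ ^ 2 := by
      rw [← CStarRing.norm_self_mul_star, e]
      have h2 : ‖(u * b k - b k) * u‖ ≤ ‖u * b k - b k‖ * 1 :=
        (norm_mul_le _ _).trans (by gcongr)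
      linarith [norm_sub_le ((u * b k - b k) * u) (u * b k - b k)]
    exact abs_le_of_sq_le_sq' (by nlinarith) hθ0.le |>.2
  set x := w * c with hx
  have hxx : x * star x = w * b k * star w := by
    simp only [hx, star_mul, hcs, ← hcc, mul_assoc]
  have hxn : ‖x‖ * ‖x‖ ≤ 1 + δ / 4 := by
    rw [← CStarRing.norm_self_mul_star, hxx]
    have := norm_add_le (w * b k * star w - q) q
    rw [sub_add_cancel] at this
    linarith
  set s : ℝ := 1 / Real.sqrt (1 + δ / 4) with hs
  have hsq : Real.sqrt (1 + δ / 4) * Real.sqrt (1 + δ / 4) = 1 + δ / 4 :=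
    Real.mul_self_sqrt (by positivity)
  have hsp : 0 < Real.sqrt (1 + δ / 4) := by positivity
  have hs0 : 0 < s := by positivity
  have hss : s * s = 1 / (1 + δ / 4) := by rw [← hsq, hs]; field_simp
  have hxs : ‖x‖ ≤ Real.sqrt (1 + δ / 4) := Real.le_sqrt_of_sq_le (by nlinarith)
  have hs1 : s * ‖x‖ ≤ 1 := by
    rw [hs, one_div, inv_mul_le_iff₀ hsp]; linarith
  have hs2 : s ≤ 1 := by
    rw [hs, div_le_one hsp]; exact Real.one_le_sqrt.2 (by linarith)
  refine ⟨(s • x) * v, ?_, ?_⟩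
  · refine (norm_mul_le _ _).trans ?_
    rw [norm_smul, Real.norm_of_nonneg hs0.le]
    exact mul_le_one₀ hs1 (norm_nonneg _) hv1
  · have e : (s • x) * v * b l * star ((s • x) * v) - q
        = (s • x) * (u * c - c) * (s • star w) + (((s * s) • (x * star x) - x * star x)
          + (w * b k * star w - q)) := by
      rw [← hxx]
      have : star x = c * star w := by rw [hx, star_mul, hcs]
      simp only [star_mul, star_smul, star_trivial, this, hu, mul_sub, sub_mul, mul_assoc,
        smul_mul_assoc, mul_smul_comm, smul_smul, smul_sub]
      abel
    have n1 : ‖(s • x) * (u * c - c) * (s • star w)‖ ≤ δ / 4 := by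
      calc _ ≤ (s * ‖x‖) * ‖u * c - c‖ * (s * ‖w‖) := by
            refine (norm_mul_le _ _).trans ?_
            rw [norm_smul, norm_star, Real.norm_of_nonneg hs0.le]
            gcongr
            refine (norm_mul_le _ _).trans ?_
            rw [norm_smul, Real.norm_of_nonneg hs0.le]
        _ ≤ 1 * θ * (1 * (‖w‖ + 1)) := by gcongr; linarith
        _ = δ / 4 := by rw [hθ]; field_simp
    have n2 : ‖(s * s) • (x * star x) - x * star x‖ ≤ δ / 4 := by
      have : (s * s) • (x * star x) - x * star x = (s * s - 1) • (x * star x) := by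
        rw [sub_smul, one_smul]
      rw [this, norm_smul, CStarRing.norm_self_mul_star]
      have h3 : ‖s * s - 1‖ = (δ / 4) / (1 + δ / 4) := by
        rw [hss, Real.norm_of_nonpos]
        · field_simp; ring
        · rw [sub_nonpos, div_le_one (by positivity)]; linarith
      rw [h3]
      calc _ ≤ (δ / 4) / (1 + δ / 4) * (1 + δ / 4) := by gcongr
        _ = δ / 4 := by field_simp
    rw [e]
    linarith [norm_add_le ((s • x) * (u * c - c) * (s • star w))
      (((s * s) • (x * star x) - x * star x) + (w * b k * star w - q)),
      norm_add_le ((s * s) • (x * star x) - x * star x) (w * b k * star w - q)]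

lemma cross {a b : ℕ → A} (han : ∀ n, ‖a n‖ ≤ 1) (hb : ∀ n, 0 ≤ b n)
    (hbn : ∀ n, ‖b n‖ ≤ 1) (ha : VeryRapidlyIncreasing a) (hv : VeryRapidlyIncreasing b)
    (hab : ∀ n, ∃ m, CuntzBelow (a n) (b m)) :
    ∀ ε > (0 : ℝ), ∀ n, ∃ m₀, ∀ m ≥ m₀,
      ∃ v : A, ‖v‖ ≤ 1 ∧ ‖v * b m * star v * a n - a n‖ < ε := by
  intro ε hε n
  obtain ⟨m, hm⟩ := ha.2 (ε / 2) (half_pos hε) n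
  obtain ⟨v, hv1, hv2⟩ := hm m le_rfl
  obtain ⟨k, hk⟩ := hab m
  obtain ⟨l₀, hl₀⟩ := approx_step (han m) hb hbn hv hk (half_pos hε)
  refine ⟨l₀, fun l hl => ?_⟩
  obtain ⟨y, hy1, hy2⟩ := hl₀ l hl
  refine ⟨v * y, (norm_mul_le _ _).trans (mul_le_one₀ hv1 (norm_nonneg _) hy1), ?_⟩
  have e : v * y * b l * star (v * y) * a n - a n
      = v * (y * b l * star y - a m) * star v * a n + (v * a m * star v * a n - a n) := by
    simp only [star_mul, mul_sub, sub_mul, mul_assoc]; abel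
  have h3 : ‖v * (y * b l * star y - a m) * star v * a n‖ ≤ ε / 2 := by
    calc _ ≤ ‖v‖ * ‖y * b l * star y - a m‖ * ‖v‖ * ‖a n‖ := by
          refine (norm_mul_le _ _).trans ?_
          gcongr
          refine (norm_mul_le _ _).trans ?_
          rw [norm_star]; gcongr; exact norm_mul_le _ _
      _ ≤ 1 * (ε / 2) * 1 * 1 := by gcongr; exact han n
      _ = ε / 2 := by ring
  rw [e]
  linarith [norm_add_le (v * (y * b l * star y - a m) * star v * a n)
    (v * a m * star v * a n - a n)]

/-- Index sequences. -/
def idx (f g : ℕ → ℕ) : ℕ → ℕ × ℕ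
  | 0 => (0, f 0)
  | k + 1 =>
    let p := idx f g k
    (max (g p.2) (p.1 + 1), max (f (max (g p.2) (p.1 + 1))) (p.2 + 1))

lemma cross_sub {a : A} {b : ℕ → A} {n : ℕ → ℕ} (hn : StrictMono n) {ε : ℝ}
    (h : ∃ m₀, ∀ m ≥ m₀, ∃ v : A, ‖v‖ ≤ 1 ∧ ‖v * b m * star v * a - a‖ < ε) :
    ∃ m₀, ∀ m ≥ m₀, ∃ v : A, ‖v‖ ≤ 1 ∧ ‖v * b (n m) * star v * a - a‖ < ε := by
  obtain ⟨m₀, h⟩ := h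
  exact ⟨m₀, fun m hm => h _ (hm.trans (hn.id_le m))⟩

theorem stmt5 (a a' : ℕ → A)
    (hpos : ∀ n, 0 ≤ a n) (hnorm : ∀ n, ‖a n‖ ≤ 1)
    (hpos' : ∀ n, 0 ≤ a' n) (hnorm' : ∀ n, ‖a' n‖ ≤ 1)
    (hvri : VeryRapidlyIncreasing a) (hvri' : VeryRapidlyIncreasing a')
    (hab : ∀ n, ∃ m, CuntzBelow (a n) (a' m))
    (hba : ∀ n, ∃ m, CuntzBelow (a' n) (a m)) :
    ∃ m n : ℕ → ℕ, StrictMono m ∧ StrictMono n ∧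
      VeryRapidlyIncreasing
        (fun k => if k % 2 = 0 then a (m (k / 2)) else a' (n (k / 2))) := by
  choose f hf using hab
  choose g hg using hba
  have hf' := fun n => cut_step hpos' hvri'.1 (hf n)
  have hg' := fun n => cut_step hpos hvri.1 (hg n)
  let s := idx (fun n => f n + 1) (fun n => g n + 1)
  let m : ℕ → ℕ := fun k => (s k).1
  let n : ℕ → ℕ := fun k => (s k).2
  have hm : StrictMono m := strictMono_nat_of_lt_succ fun k =>
    lt_of_lt_of_le (Nat.lt_succ_self _) (le_max_right _ _)
  have hn : StrictMono n := strictMono_nat_of_lt_succ fun k =>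
    lt_of_lt_of_le (Nat.lt_succ_self _) (le_max_right _ _)
  have hmn : ∀ k, f (m k) + 1 ≤ n k := by
    intro k
    cases k with
    | zero => exact le_rfl
    | succ k => exact le_max_left _ _
  have hnm : ∀ k, g (n k) + 1 ≤ m (k + 1) := fun k => le_max_left _ _
  refine ⟨m, n, hm, hn, ?_, ?_⟩
  · intro k
    rcases Nat.even_or_odd' k with ⟨j, rfl | rfl⟩
    · have h1 : (2 * j) % 2 = 0 := by omega
      have h2 : (2 * j + 1) % 2 ≠ 0 := by omega
      have h3 : (2 * j) / 2 = j := by omega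
      have h4 : (2 * j + 1) / 2 = j := by omega
      simp only [h1, h2, h3, h4, if_true, if_false]
      exact hf' _ _ (hmn j)
    · have h1 : (2 * j + 1) % 2 ≠ 0 := by omega
      have h2 : (2 * j + 1 + 1) % 2 = 0 := by omega
      have h3 : (2 * j + 1) / 2 = j := by omega
      have h4 : (2 * j + 1 + 1) / 2 = j + 1 := by omega
      simp only [h1, h2, h3, h4, if_true, if_false]
      exact hg' _ _ (hnm j)
  · intro ε hε k
    have comb : ∀ x : A,
        (∃ m₀, ∀ i ≥ m₀, ∃ v : A, ‖v‖ ≤ 1 ∧ ‖v * a (m i) * star v * x - x‖ < ε) →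
        (∃ m₀, ∀ i ≥ m₀, ∃ v : A, ‖v‖ ≤ 1 ∧ ‖v * a' (n i) * star v * x - x‖ < ε) →
        ∃ m₀, ∀ i ≥ m₀, ∃ v : A, ‖v‖ ≤ 1 ∧
          ‖v * (if i % 2 = 0 then a (m (i / 2)) else a' (n (i / 2))) * star v * x - x‖ < ε := by
      rintro x ⟨p, hp⟩ ⟨q, hq⟩
      refine ⟨2 * (p + q), fun i hi => ?_⟩
      split_ifs
      · exact hp _ (by omega)
      · exact hq _ (by omega)
    apply comb
    · dsimp only
      split_ifs
      · exact cross_sub hm (hvri.2 ε hε _)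
      · exact cross_sub hm (cross hnorm' hpos hnorm hvri' hvri (fun n => ⟨_, hg n⟩) ε hε _)
    · dsimp only
      split_ifs
      · exact cross_sub hn (cross hnorm hpos' hnorm' hvri hvri' (fun n => ⟨_, hf n⟩) ε hε _)
      · exact cross_sub hn (hvri'.2 ε hε _)
end

section
/- Let A be a C*-algebra and let a be a positive contraction in A. Setting c_n = g_{2^{−(n+1)}, 2^{−n}}(a) (continuous functional calculus), the sequence (c_n) is very rapidly increasing, c_n ≾ a for every n, and for every ε > 0 there exists n with (a−ε)₊ ≾ c_n. -/
open Filter Topology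

variable {A : Type*} [NonUnitalCStarAlgebra A] [PartialOrder A] [StarOrderedRing A]

/-- The continuous piecewise-linear function `g_{β,γ}` equal to `0` on `(−∞, β]`,
equal to `1` on `[γ, ∞)`, and linear on `[β, γ]`. -/
noncomputable def gfun (β γ t : ℝ) : ℝ := min 1 (max 0 ((t - β) / (γ - β)))

theorem gfun_cont (β γ : ℝ) : Continuous (gfun β γ) := by
  unfold gfun; fun_prop

theorem gfun_nonneg (β γ t : ℝ) : 0 ≤ gfun β γ t := by
  unfold gfun; exact le_min zero_le_one (le_max_left _ _)

theorem gfun_le_one (β γ t : ℝ) : gfun β γ t ≤ 1 := min_le_left _ _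

theorem gfun_low {β γ t : ℝ} (h : β < γ) (ht : t ≤ β) : gfun β γ t = 0 := by
  unfold gfun
  have : (t - β) / (γ - β) ≤ 0 := div_nonpos_of_nonpos_of_nonneg (by linarith) (by linarith)
  rw [max_eq_left this]; norm_num

theorem gfun_high {β γ t : ℝ} (h : β < γ) (ht : γ ≤ t) : gfun β γ t = 1 := by
  unfold gfun
  have : 1 ≤ (t - β) / (γ - β) := by rw [le_div_iff₀ (by linarith)]; linarith
  exact min_eq_left (this.trans (le_max_right _ _))

theorem sandwich (a : A) (ha : 0 ≤ a) (f g h : ℝ → ℝ) (hg : Continuous g) (hh : Continuous h)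
    (hg0 : g 0 = 0) (hh0 : h 0 = 0) (H : ∀ t, h t * g t * h t = f t) :
    cfcₙ h a * cfcₙ g a * star (cfcₙ h a) = cfcₙ f a := by
  have hs : star (cfcₙ h a) = cfcₙ h a := (cfcₙ_predicate h a : IsSelfAdjoint _).star_eq
  have hf : f = fun t => h t * g t * h t := funext fun t => (H t).symm
  rw [hs, hf, cfcₙ_mul (fun t => h t * g t) h a (by fun_prop) (by simp [hh0]) (by fun_prop) hh0,
    cfcₙ_mul h g a (by fun_prop) hh0 (by fun_prop) hg0]

theorem below_of (a : A) (ha : 0 ≤ a) (f g h : ℝ → ℝ) (hg : Continuous g) (hh : Continuous h)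
    (hg0 : g 0 = 0) (hh0 : h 0 = 0) (H : ∀ t, h t * g t * h t = f t) :
    CuntzBelow (cfcₙ f a) (cfcₙ g a) := by
  refine ⟨fun _ => cfcₙ h a, ?_⟩
  simp [sandwich a ha f g h hg hh hg0 hh0 H]

theorem two_lt (n : ℕ) : ((2 : ℝ) ^ (n + 1))⁻¹ < ((2 : ℝ) ^ n)⁻¹ :=
  inv_strictAnti₀ (by positivity) (pow_lt_pow_right₀ (by norm_num) (Nat.lt_succ_self n))

theorem stmt7 (a : A) (ha : 0 ≤ a) (ha1 : ‖a‖ ≤ 1) :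
    VeryRapidlyIncreasing
      (fun n : ℕ => cfcₙ (gfun ((2 : ℝ) ^ (n + 1))⁻¹ ((2 : ℝ) ^ n)⁻¹) a) ∧
    (∀ n : ℕ, CuntzBelow (cfcₙ (gfun ((2 : ℝ) ^ (n + 1))⁻¹ ((2 : ℝ) ^ n)⁻¹) a) a) ∧
    (∀ ε : ℝ, 0 < ε →
      ∃ n : ℕ, CuntzBelow (cutP a ε) (cfcₙ (gfun ((2 : ℝ) ^ (n + 1))⁻¹ ((2 : ℝ) ^ n)⁻¹) a)) := by
  have hsa : IsSelfAdjoint a := ha.isSelfAdjoint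
  have hpos : ∀ n : ℕ, (0 : ℝ) < ((2 : ℝ) ^ n)⁻¹ := fun n => by positivity
  have hc : ∀ n : ℕ, Continuous (gfun ((2 : ℝ) ^ (n + 1))⁻¹ ((2 : ℝ) ^ n)⁻¹) :=
    fun n => gfun_cont _ _
  have h0 : ∀ n : ℕ, gfun ((2 : ℝ) ^ (n + 1))⁻¹ ((2 : ℝ) ^ n)⁻¹ 0 = 0 :=
    fun n => gfun_low (two_lt n) (hpos _).le
  have hnn : ∀ (n : ℕ) (t : ℝ), 0 ≤ gfun ((2 : ℝ) ^ (n + 1))⁻¹ ((2 : ℝ) ^ n)⁻¹ t :=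
    fun n t => gfun_nonneg _ _ _
  have h1 : ∀ (n : ℕ) (t : ℝ), gfun ((2 : ℝ) ^ (n + 1))⁻¹ ((2 : ℝ) ^ n)⁻¹ t ≤ 1 :=
    fun n t => gfun_le_one _ _ _
  have hlow : ∀ (n : ℕ) (t : ℝ), t ≤ ((2 : ℝ) ^ (n + 1))⁻¹ →
      gfun ((2 : ℝ) ^ (n + 1))⁻¹ ((2 : ℝ) ^ n)⁻¹ t = 0 := fun n t ht => gfun_low (two_lt n) ht
  have hhigh : ∀ (n : ℕ) (t : ℝ), ((2 : ℝ) ^ n)⁻¹ ≤ t →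
      gfun ((2 : ℝ) ^ (n + 1))⁻¹ ((2 : ℝ) ^ n)⁻¹ t = 1 := fun n t ht => gfun_high (two_lt n) ht
  have hanti : ∀ m n : ℕ, n ≤ m → ((2 : ℝ) ^ m)⁻¹ ≤ ((2 : ℝ) ^ n)⁻¹ := fun m n h =>
    inv_anti₀ (by positivity) (pow_le_pow_right₀ (by norm_num) h)
  generalize hG : (fun n : ℕ => gfun ((2 : ℝ) ^ (n + 1))⁻¹ ((2 : ℝ) ^ n)⁻¹) = G
  have hG' : ∀ n : ℕ, gfun ((2 : ℝ) ^ (n + 1))⁻¹ ((2 : ℝ) ^ n)⁻¹ = G n := fun n => by rw [← hG]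
  simp only [hG'] at *
  refine ⟨⟨?_, ?_⟩, ?_, ?_⟩
  · intro n
    refine ⟨1 / 2, by norm_num, ?_⟩
    have hcomp : cutP (cfcₙ (G (n + 1)) a) (1 / 2) =
        cfcₙ (fun t => max (G (n + 1) t - 1 / 2) 0) a := by
      unfold cutP
      exact (cfcₙ_comp' (fun t : ℝ => max (t - 1 / 2) 0) (G (n + 1)) a
        (by fun_prop) (by norm_num) ((hc (n + 1)).continuousOn) (h0 (n + 1)) hsa).symm
    simp only [hcomp]
    have := hc (n + 1)
    have := hc n
    refine below_of a ha _ _ (fun t => √(2 * G n t)) (by fun_prop) (by fun_prop)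
      (by simp [h0]) (by simp [h0]) fun t => ?_
    rcases le_total t ((2 : ℝ) ^ (n + 1))⁻¹ with ht | ht
    · simp [hlow n t ht]
    · have hs := Real.mul_self_sqrt (mul_nonneg zero_le_two (hnn n t))
      rw [hhigh (n + 1) t ht, mul_right_comm, hs]
      norm_num
      ring
  · intro ε hε n
    refine ⟨n + 1, fun m hm => ⟨cfcₙ (G (n + 1)) a, ?_, ?_⟩⟩
    · refine norm_cfcₙ_le fun t _ => ?_
      rw [Real.norm_of_nonneg (hnn _ t)]
      exact h1 _ t
    · have := hc m
      have := hc (n + 1)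
      have := hc n
      simp only
      rw [sandwich a ha (fun t => G (n + 1) t * G m t * G (n + 1) t) (G m) (G (n + 1)) (hc _) (hc _)
        (h0 _) (h0 _) (fun t => rfl), ← cfcₙ_mul (fun t => G (n + 1) t * G m t * G (n + 1) t) (G n) a
        (by fun_prop) (by simp [h0]) (by fun_prop) (h0 n)]
      have : (fun t => G (n + 1) t * G m t * G (n + 1) t * G n t) = G n := by
        funext t
        rcases le_total t ((2 : ℝ) ^ (n + 1))⁻¹ with ht | ht
        · simp [hlow n t ht]
        · simp [hhigh (n + 1) t ht, hhigh m t ((hanti m (n + 1) hm).trans ht)]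
      rw [this]
      simpa using hε
  · intro n
    have hδ := hpos (n + 1)
    have := hc n
    have key := below_of a ha (G n) (fun t => t) (fun t => √(G n t / max t ((2 : ℝ) ^ (n + 1))⁻¹))
      (by fun_prop)
      (Real.continuous_sqrt.comp ((hc n).div (by fun_prop) fun t => (lt_max_of_lt_right hδ).ne'))
      rfl (by simp [h0]) fun t => ?_
    · rwa [cfcₙ_id' ℝ a hsa] at key
    · have hm : 0 < max t ((2 : ℝ) ^ (n + 1))⁻¹ := lt_max_of_lt_right hδ
      have hs := Real.mul_self_sqrt (div_nonneg (hnn n t) hm.le)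
      rw [mul_right_comm, hs]
      rcases le_total t ((2 : ℝ) ^ (n + 1))⁻¹ with ht | ht
      · simp [hlow n t ht]
      · rw [max_eq_left ht]
        have : t ≠ 0 := (hδ.trans_le ht).ne'
        field_simp
  · intro ε hε
    obtain ⟨n, hn⟩ := exists_pow_lt_of_lt_one hε (by norm_num : (1 / 2 : ℝ) < 1)
    refine ⟨n, ?_⟩
    unfold cutP
    refine below_of a ha _ (G n) (fun t => √(max (t - ε) 0)) (hc n) (by fun_prop) (h0 n)
      (by simp [hε.le]) fun t => ?_
    rw [mul_right_comm, Real.mul_self_sqrt (le_max_right _ _)]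
    rcases le_total t ε with ht | ht
    · rw [max_eq_right (by linarith)]; simp
    · rw [hhigh n t, mul_one]
      have : ((2 : ℝ) ^ n)⁻¹ = (1 / 2) ^ n := by simp
      linarith
end
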